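/- arXiv:1407.6409 — 2 statements merged into one kernel-verified Lean document; each statement's English description precedes it below -/
import Mathlib

section
/- Let E be a field, A an n-dimensional E-vector space, and ψ_1,…,ψ_m ∈ Hom_E(A,E) with m ≤ n; let Ψ := ⊕_{i=1}^m ψ_i : A → E^{⊕m}. Then the image of the map ψ_1∧⋯∧ψ_m : ⋀^n_E A → ⋀^{n−m}_E A equals the subspace ⋀^{n−m}_E ker(Ψ) of ⋀^{n−m}_E A if Ψ is surjective, and equals 0 if Ψ is not surjective. -/
open ExteriorAlgebra

set_option synthInstance.maxHeartbeats 1000000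
set_option maxHeartbeats 1000000

noncomputable section

variable {E : Type*} [Field E] {A : Type*} [AddCommGroup A] [Module E A]

/-- The element `a₁ ∧ ⋯ ∧ a_n` of `⋀^n A`. -/
def wedge (n : ℕ) (m : Fin n → A) : ↥(⋀[E]^n A) :=
  ⟨ιMulti E n m, ιMulti_range E n ⟨m, rfl⟩⟩

/-- `ctr` implements, for every functional `d : A → E` and every degree, the contraction
`⋀^{k+1} A → ⋀^k A` sending `a₁ ∧ ⋯ ∧ a_{k+1}` to
`∑ᵢ (-1)^{i-1} d(aᵢ) a₁ ∧ ⋯ ∧ âᵢ ∧ ⋯ ∧ a_{k+1}`. -/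
def IsContractionFamily
    (ctr : ∀ k : ℕ, (A →ₗ[E] E) → (↥(⋀[E]^(k+1) A) →ₗ[E] ↥(⋀[E]^k A))) : Prop :=
  ∀ (k : ℕ) (d : A →ₗ[E] E) (m : Fin (k+1) → A),
    ctr k d (wedge (k+1) m) =
      ∑ i : Fin (k+1), ((-1 : E) ^ (i : ℕ) * d (m i)) •
        wedge k (fun j => m (i.succAbove j))

/-- The iterated contraction `ψ_s ∘ ⋯ ∘ ψ_1 : ⋀^{k+s} A → ⋀^k A` attached to a family
`ψ = (ψ_1, …, ψ_s)` of functionals (i.e. the map induced by `ψ_1 ∧ ⋯ ∧ ψ_s`). -/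
def iterCtr (ctr : ∀ k : ℕ, (A →ₗ[E] E) → (↥(⋀[E]^(k+1) A) →ₗ[E] ↥(⋀[E]^k A))) :
    ∀ (s k : ℕ), (Fin s → (A →ₗ[E] E)) → (↥(⋀[E]^(k+s) A) →ₗ[E] ↥(⋀[E]^k A))
  | 0, _, _ => LinearMap.id
  | (s+1), k, f => (iterCtr ctr s k (Fin.tail f)).comp (ctr (k+s) (f 0))

lemma map_mem_exteriorPower {B : Type*} [AddCommGroup B] [Module E B]
    (n : ℕ) (f : B →ₗ[E] A) {x : ExteriorAlgebra E B}
    (hx : x ∈ ⋀[E]^n B) : ExteriorAlgebra.map f x ∈ ⋀[E]^n A := by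
  have h1 : Submodule.map (ExteriorAlgebra.map f).toLinearMap (⋀[E]^n B) ≤ ⋀[E]^n A := by
    rw [show (⋀[E]^n B) = (LinearMap.range (ι E (M := B))) ^ n from rfl,
      Submodule.map_pow]
    refine pow_le_pow_left' ?_ n
    rw [ι_range_map_map]
    rintro y ⟨m, -, rfl⟩
    exact LinearMap.mem_range_self _ _
  exact h1 ⟨x, hx, rfl⟩

/-- Functoriality of exterior powers; used below to regard `⋀^k W` (for a subspace `W ⊆ A`)
as a subspace of `⋀^k A`. -/
def exteriorPowerMap {B : Type*} [AddCommGroup B] [Module E B]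
    (n : ℕ) (f : B →ₗ[E] A) : ↥(⋀[E]^n B) →ₗ[E] ↥(⋀[E]^n A) :=
  (ExteriorAlgebra.map f).toLinearMap.restrict
    (fun _ hx => map_mem_exteriorPower n f hx)

lemma exteriorPower_hom_ext_wedge {N : Type*} [AddCommGroup N] [Module E N] {n : ℕ}
    {f g : ↥(⋀[E]^n A) →ₗ[E] N} (h : ∀ v : Fin n → A, f (wedge n v) = g (wedge n v)) : f = g :=
  exteriorPower.linearMap_ext (AlternatingMap.ext h)

lemma contractLeft_ιMulti_succ (d : A →ₗ[E] E) (n : ℕ) (v : Fin (n + 1) → A) :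
    CliffordAlgebra.contractLeft (Q := (0 : QuadraticForm E A)) d (ιMulti E (n + 1) v) =
      ∑ i : Fin (n + 1), ((-1 : E) ^ (i : ℕ) * d (v i)) •
        ιMulti E n (fun j => v (i.succAbove j)) := by
  induction n with
  | zero =>
    simp [Algebra.algebraMap_eq_smul_one]
  | succ n ih =>
    have h := CliffordAlgebra.contractLeft_ι_mul (Q := (0 : QuadraticForm E A)) (d := d) (v 0)
      (ιMulti E (n + 1) (Matrix.vecTail v))
    rw [ιMulti_succ_apply]
    refine h.trans ?_
    rw [ih, Fin.sum_univ_succ (n := n + 1), sub_eq_add_neg, Finset.mul_sum,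
      ← Finset.sum_neg_distrib]
    congr 1
    · simp [Matrix.vecTail, Function.comp_def]
    · refine Finset.sum_congr rfl fun i _ => ?_
      rw [ιMulti_succ_apply (fun j => v (i.succ.succAbove j)), mul_smul_comm, ← neg_smul]
      simp [Matrix.vecTail, Function.comp_def, pow_succ]

namespace IsContractionFamily

variable {ctr : ∀ k : ℕ, (A →ₗ[E] E) → (↥(⋀[E]^(k+1) A) →ₗ[E] ↥(⋀[E]^k A))}

lemma coe_apply (hctr : IsContractionFamily ctr) (k : ℕ) (d : A →ₗ[E] E)
    (x : ↥(⋀[E]^(k+1) A)) :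
    (ctr k d x : ExteriorAlgebra E A) =
      CliffordAlgebra.contractLeft (Q := (0 : QuadraticForm E A)) d (x : ExteriorAlgebra E A) := by
  suffices h : (⋀[E]^k A).subtype ∘ₗ ctr k d =
      (CliffordAlgebra.contractLeft (Q := (0 : QuadraticForm E A)) d) ∘ₗ
        (⋀[E]^(k+1) A).subtype from LinearMap.congr_fun h x
  refine exteriorPower_hom_ext_wedge fun v => ?_
  refine Eq.trans ?_ (contractLeft_ιMulti_succ d k v).symm
  simp only [LinearMap.comp_apply, Submodule.subtype_apply]
  rw [hctr k d v]
  simp [wedge]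

lemma apply_self (hctr : IsContractionFamily ctr) (k : ℕ) (d : A →ₗ[E] E) :
    ctr k d ∘ₗ ctr (k + 1) d = 0 := by
  refine LinearMap.ext fun x => Subtype.ext ?_
  simp only [LinearMap.comp_apply, hctr.coe_apply]
  exact CliffordAlgebra.contractLeft_contractLeft (Q := (0 : QuadraticForm E A)) d _

lemma anticomm (hctr : IsContractionFamily ctr) (k : ℕ) (d d' : A →ₗ[E] E) :
    ctr k d ∘ₗ ctr (k + 1) d' = -(ctr k d' ∘ₗ ctr (k + 1) d) := by
  refine LinearMap.ext fun x => Subtype.ext ?_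
  simp only [LinearMap.comp_apply, LinearMap.neg_apply, Submodule.coe_neg, hctr.coe_apply]
  exact CliffordAlgebra.contractLeft_comm (Q := (0 : QuadraticForm E A)) d d' _

lemma map_zero (hctr : IsContractionFamily ctr) (k : ℕ) : ctr k 0 = 0 :=
  exteriorPower_hom_ext_wedge fun v => by simp [hctr k 0 v]

lemma map_add (hctr : IsContractionFamily ctr) (k : ℕ) (d d' : A →ₗ[E] E) :
    ctr k (d + d') = ctr k d + ctr k d' :=
  exteriorPower_hom_ext_wedge fun v => by
    simp [hctr k _ v, mul_add, add_smul, Finset.sum_add_distrib]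

lemma map_smul (hctr : IsContractionFamily ctr) (k : ℕ) (c : E) (d : A →ₗ[E] E) :
    ctr k (c • d) = c • ctr k d :=
  exteriorPower_hom_ext_wedge fun v => by
    simp [hctr k _ v, Finset.smul_sum, smul_smul, mul_left_comm]

lemma iterCtr_comp_self (hctr : IsContractionFamily ctr) (s k : ℕ) (f : Fin s → (A →ₗ[E] E))
    (i : Fin s) : iterCtr ctr s k f ∘ₗ ctr (k + s) (f i) = 0 := by
  induction s with
  | zero => exact i.elim0
  | succ s ih =>
    have key : (iterCtr ctr s k (Fin.tail f) ∘ₗ ctr (k + s) (f 0)) ∘ₗ ctr (k + s + 1) (f i) = 0 := by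
      rw [LinearMap.comp_assoc]
      induction i using Fin.cases with
      | zero => rw [hctr.apply_self, LinearMap.comp_zero]
      | succ j =>
        have h : iterCtr ctr s k (Fin.tail f) ∘ₗ ctr (k + s) (f j.succ) = 0 := ih (Fin.tail f) j
        refine LinearMap.ext fun x => ?_
        rw [hctr.anticomm, LinearMap.comp_apply, LinearMap.neg_apply, _root_.map_neg]
        exact neg_eq_zero.2 (LinearMap.congr_fun h _)
    exact key

lemma iterCtr_eq_zero (hctr : IsContractionFamily ctr) (s k : ℕ) (f : Fin s → (A →ₗ[E] E))
    (hf : ¬ LinearIndependent E f) : iterCtr ctr s k f = 0 := by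
  induction s with
  | zero => exact absurd (linearIndependent_empty_type) hf
  | succ s ih =>
    change iterCtr ctr s k (Fin.tail f) ∘ₗ ctr (k + s) (f 0) = 0
    rw [linearIndependent_finSucc, not_and_or, not_not] at hf
    rcases hf with hf | hf
    · rw [ih _ hf, LinearMap.zero_comp]
    · generalize f 0 = d₀ at hf ⊢
      induction hf using Submodule.span_induction with
      | mem d hd =>
        obtain ⟨i, rfl⟩ := hd
        exact hctr.iterCtr_comp_self s k _ i
      | zero => rw [hctr.map_zero, LinearMap.comp_zero]
      | add d d' _ _ hd hd' => rw [hctr.map_add, LinearMap.comp_add, hd, hd', add_zero]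
      | smul c d _ hd => rw [hctr.map_smul, LinearMap.comp_smul, hd, smul_zero]

end IsContractionFamily

/-- The family `(w₁, …, w_s, e₁, …, e_k)`, indexed so as to match the recursion of `iterCtr`. -/
def prependFamily {X : Type*} {k : ℕ} (e : Fin k → X) : ∀ s : ℕ, (Fin s → X) → (Fin (k + s) → X)
  | 0, _ => e
  | (s+1), w => Fin.cons (w 0) (prependFamily e s (Fin.tail w))

lemma range_prependFamily {X : Type*} {k : ℕ} (e : Fin k → X) (s : ℕ) (w : Fin s → X) :
    Set.range (prependFamily e s w) = Set.range w ∪ Set.range e := by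
  induction s with
  | zero => simp [prependFamily]
  | succ s ih =>
    rw [← Fin.cons_self_tail w, Fin.range_cons, Set.insert_union, ← ih]
    exact Fin.range_cons _ _

lemma IsContractionFamily.iterCtr_wedge_prependFamily
    {ctr : ∀ k : ℕ, (A →ₗ[E] E) → (↥(⋀[E]^(k+1) A) →ₗ[E] ↥(⋀[E]^k A))}
    (hctr : IsContractionFamily ctr) {k : ℕ} (e : Fin k → A) (s : ℕ)
    (f : Fin s → (A →ₗ[E] E)) (w : Fin s → A) (hfw : ∀ i j, f i (w j) = if i = j then 1 else 0)
    (hfe : ∀ i j, f i (e j) = 0) :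
    iterCtr ctr s k f (wedge (k + s) (prependFamily e s w)) = wedge k e := by
  induction s with
  | zero => rfl
  | succ s ih =>
    have hzero (i : Fin (k + s)) : f 0 (prependFamily e s (Fin.tail w) i) = 0 := by
      have hi : prependFamily e s (Fin.tail w) i ∈ Set.range (Fin.tail w) ∪ Set.range e :=
        range_prependFamily e s (Fin.tail w) ▸ Set.mem_range_self i
      rcases hi with ⟨j, hj⟩ | ⟨j, hj⟩
      · rw [← hj, Fin.tail, hfw, if_neg (Fin.succ_ne_zero j).symm]
      · rw [← hj, hfe]
    have hstep : ctr (k + s) (f 0) (wedge (k + s + 1) (prependFamily e (s + 1) w)) =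
        wedge (k + s) (prependFamily e s (Fin.tail w)) := by
      rw [hctr, prependFamily, Fin.sum_univ_succ]
      simp [hzero, hfw]
    change iterCtr ctr s k (Fin.tail f) (ctr (k + s) (f 0) _) = _
    refine (congrArg _ hstep).trans ?_
    refine ih _ _ (fun i j => ?_) (fun i j => hfe _ _)
    simp [Fin.tail, hfw]

lemma span_singleton_wedge_eq_top {n : ℕ} {v : Fin n → A}
    (hv : Submodule.span E (Set.range v) = ⊤) :
    Submodule.span E {wedge (E := E) n v} = ⊤ := by
  rw [← top_le_iff, ← exteriorPower.ιMulti_family_span_of_span (n := n) E hv]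
  refine Submodule.span_mono ?_
  rintro _ ⟨s, rfl⟩
  have hs : ⇑(Set.powersetCard.ofFinEmbEquiv.symm s) = id :=
    (OrderEmbedding.strictMono _).range_inj strictMono_id |>.1 <| by
      rw [Set.range_id, Set.range_eq_univ]
      exact Finite.surjective_of_injective (RelEmbedding.injective _)
  rw [exteriorPower.ιMulti_family, hs]
  rfl

lemma range_eq_span_singleton_wedge {N : Type*} [AddCommGroup N] [Module E N] {n : ℕ}
    {v : Fin n → A} (hv : Submodule.span E (Set.range v) = ⊤) (f : ↥(⋀[E]^n A) →ₗ[E] N) :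
    LinearMap.range f = Submodule.span E {f (wedge n v)} := by
  rw [LinearMap.range_eq_map, ← span_singleton_wedge_eq_top hv, Submodule.map_span,
    Set.image_singleton]

lemma exteriorPowerMap_wedge {B : Type*} [AddCommGroup B] [Module E B] (n : ℕ) (f : B →ₗ[E] A)
    (v : Fin n → B) : exteriorPowerMap n f (wedge n v) = wedge n (f ∘ v) :=
  Subtype.ext (ExteriorAlgebra.map_apply_ιMulti f v)

lemma surjective_pi_of_linearIndependent {ι : Type*} [Finite ι] {ψ : ι → (A →ₗ[E] E)}
    (hψ : LinearIndependent E ψ) : Function.Surjective (LinearMap.pi ψ) := by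
  classical
  have := Fintype.ofFinite ι
  rw [← LinearMap.range_eq_top]
  by_contra h
  obtain ⟨g, hg, hle⟩ := Submodule.exists_le_ker_of_lt_top _ (lt_top_iff_ne_top.2 h)
  refine hg (LinearMap.pi_ext' fun i => LinearMap.ext_ring ?_)
  refine Fintype.linearIndependent_iff.1 hψ (fun i => g (Pi.single i 1)) ?_ i
  ext a
  have ha : g (LinearMap.pi ψ a) = 0 := hle (LinearMap.mem_range_self _ a)
  rw [pi_eq_sum_univ' (LinearMap.pi ψ a), map_sum] at ha
  simpa [mul_comm] using ha

/-- Let `E` be a field, `A` an `n`-dimensional `E`-vector space and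
`ψ₁, …, ψ_m ∈ Hom_E(A, E)` with `m ≤ n` (here we write `n = k + m`); let
`Ψ := ⊕ᵢ ψᵢ : A → E^m`.  Then the image of the map `ψ₁ ∧ ⋯ ∧ ψ_m : ⋀^n A → ⋀^{n-m} A`
(the iterated contraction) equals the subspace `⋀^{n-m} ker Ψ` of `⋀^{n-m} A` if `Ψ` is
surjective, and equals `0` if `Ψ` is not surjective. -/
theorem range_iterated_contraction_top_exteriorPower
    [FiniteDimensional E A] (k m : ℕ) (hdim : Module.finrank E A = k + m)
    (ψ : Fin m → (A →ₗ[E] E))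
    (ctr : ∀ j : ℕ, (A →ₗ[E] E) → (↥(⋀[E]^(j+1) A) →ₗ[E] ↥(⋀[E]^j A)))
    (hctr : IsContractionFamily ctr) :
    (Function.Surjective (LinearMap.pi ψ) →
      LinearMap.range (iterCtr ctr m k ψ) =
        LinearMap.range
          (exteriorPowerMap k (LinearMap.ker (LinearMap.pi ψ)).subtype)) ∧
    (¬ Function.Surjective (LinearMap.pi ψ) →
      LinearMap.range (iterCtr ctr m k ψ) = ⊥) := by
  refine ⟨fun hsurj => ?_, fun hsurj => ?_⟩
  · have hker : Module.finrank E (LinearMap.ker (LinearMap.pi ψ)) = k := by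
      have h := LinearMap.finrank_range_add_finrank_ker (LinearMap.pi ψ)
      rw [LinearMap.range_eq_top.2 hsurj, finrank_top, Module.finrank_fin_fun, hdim] at h
      omega
    let b := Module.finBasisOfFinrankEq E _ hker
    let e : Fin k → A := (LinearMap.ker (LinearMap.pi ψ)).subtype ∘ b
    choose w hw using fun j : Fin m => hsurj (Pi.single j 1)
    have hfw (i j : Fin m) : ψ i (w j) = if i = j then 1 else 0 := by
      simpa [Pi.single_apply] using congrFun (hw j) i
    have hfe (i : Fin m) (j : Fin k) : ψ i (e j) = 0 := congrFun (b j).2 i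
    have hspan : Submodule.span E (Set.range (prependFamily e m w)) = ⊤ := by
      rw [range_prependFamily, Submodule.span_union, eq_top_iff]
      rintro a -
      have hspane : Submodule.span E (Set.range e) = LinearMap.ker (LinearMap.pi ψ) := by
        rw [Set.range_comp, Submodule.span_image, b.span_eq, Submodule.map_top,
          Submodule.range_subtype]
      rw [hspane]
      have hmem : ∑ i, ψ i a • w i ∈ Submodule.span E (Set.range w) :=
        Submodule.sum_mem _ fun i _ =>
          Submodule.smul_mem _ _ (Submodule.subset_span (Set.mem_range_self i))
      have hsub : a - ∑ i, ψ i a • w i ∈ LinearMap.ker (LinearMap.pi ψ) := by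
        rw [LinearMap.mem_ker]
        ext i
        simp [hfw]
      simpa using Submodule.add_mem_sup hmem hsub
    rw [range_eq_span_singleton_wedge hspan, range_eq_span_singleton_wedge b.span_eq,
      hctr.iterCtr_wedge_prependFamily e m ψ w hfw hfe, exteriorPowerMap_wedge]
  · rw [hctr.iterCtr_eq_zero m k ψ (mt surjective_pi_of_linearIndependent hsurj),
      LinearMap.range_zero]

end
end

section
/- Let R be a commutative noetherian ring, M a finitely generated R-module and N ⊆ M a submodule such that M/N admits a quadratic presentation, i.e. an exact sequence R^{⊕n} → R^{⊕n} → M/N → 0 for some n. Then for every integer b ≥ 0 one has F^{(0,b)}_R(M,N) = Fitt^b_R(N)·Fitt^0_R(M/N); equivalently, Σ_X Fitt^0_R(M/X) = Fitt^b_R(N)·Fitt^0_R(M/N), where the sum is over all submodules X of N generated by b elements. -/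
/-- The `i`-th Fitting ideal of a module `M` over a commutative ring `R` (defined as the
supremum over all finite presentations of the ideal of `(n-i) × (n-i)` minors of a relation
matrix; this is independent of the presentation). -/
noncomputable def fittingIdeal (R : Type*) [CommRing R] (M : Type*) [AddCommGroup M]
    [Module R M] (i : ℕ) : Ideal R :=
  ⨆ (n : ℕ) (π : (Fin n → R) →ₗ[R] M) (_ : Function.Surjective π),
    Ideal.span { d : R | ∃ (ρ : Fin (n - i) → Fin n) (c : Fin (n - i) → (Fin n → R)),
      (∀ b, π (c b) = 0) ∧ d = Matrix.det (Matrix.of fun a b => c b (ρ a)) }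

/-- The relative Fitting ideal `Fitt^{(a,b)}_R(M, N)`, described via
`Fitt^{(a,b)}_R(M,N) = Σ_X Fitt^0_R(M/X)`, the sum of ideals being taken over all submodules
`X` of `M` generated by `a + b` elements `x₁, …, x_{a+b}` with `x₁, …, x_b ∈ N`. -/
noncomputable def relativeFittingIdeal (R : Type*) [CommRing R] (M : Type*) [AddCommGroup M]
    [Module R M] (a b : ℕ) (N : Submodule R M) : Ideal R :=
  ⨆ (X : Submodule R M) (_ : ∃ s : Fin (a + b) → M,
      (∀ i : Fin (a + b), (i : ℕ) < b → s i ∈ N) ∧ X = Submodule.span R (Set.range s)),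
    fittingIdeal R (M ⧸ X) 0

theorem MultilinearMap.map_mem_of_forall_mem_span {R ι V : Type*} [CommRing R] [AddCommGroup V]
    [Module R V] [Finite ι] (f : MultilinearMap R (fun _ : ι => V) R) (I : Ideal R)
    (S : ι → Set V) (h : ∀ v : ι → V, (∀ j, v j ∈ S j) → f v ∈ I)
    (w : ι → V) (hw : ∀ j, w j ∈ Submodule.span R (S j)) : f w ∈ I := by
  classical
  cases nonempty_fintype ι
  suffices H : ∀ (t : Finset ι) (w : ι → V), (∀ j ∈ t, w j ∈ Submodule.span R (S j)) →
      (∀ j ∉ t, w j ∈ S j) → f w ∈ I from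
    H Finset.univ w (fun j _ => hw j) (fun j hj => absurd (Finset.mem_univ j) hj)
  intro t
  induction t using Finset.induction_on with
  | empty => exact fun w _ hw => h w fun j => hw j (Finset.notMem_empty j)
  | insert i t hi ih =>
    intro w hw hw'
    suffices H : ∀ x ∈ Submodule.span R (S i), f (Function.update w i x) ∈ I by
      simpa using H (w i) (hw i (Finset.mem_insert_self i t))
    intro x hx
    induction hx using Submodule.span_induction with
    | mem x hx =>
      refine ih _ (fun j hj => ?_) (fun j hj => ?_)
      · rw [Function.update_of_ne (by rintro rfl; exact hi hj)]
        exact hw j (Finset.mem_insert_of_mem hj)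
      · by_cases hji : j = i
        · subst hji
          simpa using hx
        · rw [Function.update_of_ne hji]
          exact hw' j (by simp [hji, hj])
    | zero => simp
    | add x y _ _ hx hy => rw [f.map_update_add]; exact I.add_mem hx hy
    | smul a x _ hx => rw [f.map_update_smul]; exact I.mul_mem_left a hx

theorem Matrix.det_mem_of_forall_mem_span {R ι : Type*} [CommRing R] [Fintype ι] [DecidableEq ι]
    (I : Ideal R) (S : ι → Set (ι → R))
    (h : ∀ V : Matrix ι ι R, (∀ j, V j ∈ S j) → V.det ∈ I)
    (W : Matrix ι ι R) (hW : ∀ j, W j ∈ Submodule.span R (S j)) : W.det ∈ I :=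
  (Matrix.detRowAlternating (n := ι) (R := R)).toMultilinearMap.map_mem_of_forall_mem_span I S h W hW

/-- A determinant lies in every ideal containing all maximal minors of some selection of rows. -/
theorem Matrix.det_mem_of_minors_mem {R ι α : Type*} [CommRing R] [Fintype ι] [DecidableEq ι]
    [Fintype α] [DecidableEq α] (I : Ideal R) (W : Matrix ι ι R) (κ : α → ι)
    (hκ : Function.Injective κ) (h : ∀ ρ : α → ι, (W.submatrix κ ρ).det ∈ I) : W.det ∈ I := by
  classical
  refine Matrix.det_mem_of_forall_mem_span I
    (fun j => if j ∈ Set.range κ then {W j} else Set.range fun i : ι => Pi.single i (1 : R))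
    (fun v hv => ?_) W (fun j => ?_)
  · have hv1 : ∀ a, v (κ a) = W (κ a) := fun a => by simpa using hv (κ a)
    have hv2 : ∀ j, ∃ i : ι, j ∉ Set.range κ → v j = Pi.single i (1 : R) := fun j => by
      by_cases hj : j ∈ Set.range κ
      · exact ⟨j, fun h => absurd hj h⟩
      · have := hv j
        simp only [if_neg hj] at this
        obtain ⟨i, hi⟩ := this
        exact ⟨i, fun _ => hi.symm⟩
    choose τ hτ using hv2
    by_cases hinj : Set.InjOn τ ((Set.range κ)ᶜ)
    · obtain ⟨g, hg⟩ := Finset.exists_equiv_extend_of_card_eq (t := (Finset.univ : Finset ι))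
        (s := Finset.univ.filter (· ∉ Set.range κ)) (f := τ) (by simp)
        (Finset.subset_univ _) (by
          intro x hx y hy
          exact hinj (by simpa using hx) (by simpa using hy))
      let σ : Equiv.Perm ι := g.trans (Equiv.subtypeUnivEquiv (by simp))
      have hσ : ∀ j ∉ Set.range κ, σ j = τ j := fun j hj =>
        hg j (Finset.mem_filter.2 ⟨Finset.mem_univ j, hj⟩)
      have hdet : (v.submatrix id σ).det ∈ I := by
        have hrow : ∀ j ∉ Set.range κ, ∀ i,
            v.submatrix id σ j i = if i = j then 1 else 0 := by
          intro j hj i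
          simp [hτ j hj, ← hσ j hj, Pi.single_apply]
        rw [Matrix.twoBlockTriangular_det _ (· ∈ Set.range κ) (fun i hi j hj => by
          rw [hrow i hi, if_neg (by rintro rfl; exact hi hj)])]
        refine I.mul_mem_right _ ?_
        let e : α ≃ {x // x ∈ Set.range κ} := Equiv.ofInjective κ hκ
        have hB : ((v.submatrix id σ).toSquareBlockProp (· ∈ Set.range κ)).submatrix e e =
            W.submatrix κ (σ ∘ κ) := by
          ext a b
          simp [Matrix.toSquareBlockProp, e, hv1]
        have hκσ := h (σ ∘ κ)
        rw [← hB, Matrix.det_submatrix_equiv_self] at hκσ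
        convert hκσ
      rw [Matrix.det_permute'] at hdet
      rcases Int.units_eq_one_or (Equiv.Perm.sign σ) with hs | hs <;> simpa [hs] using hdet
    · simp only [Set.InjOn, not_forall] at hinj
      obtain ⟨x, hx, y, hy, hxy, hne⟩ := hinj
      rw [Matrix.det_zero_of_row_eq hne (by rw [hτ x hx, hτ y hy, hxy])]
      exact I.zero_mem
  · by_cases hj : j ∈ Set.range κ
    · simp only [if_pos hj]
      exact Submodule.subset_span rfl
    · simp only [if_neg hj]
      have := (Pi.basisFun R ι).mem_span (W j)
      rwa [show ⇑(Pi.basisFun R ι) = fun i => Pi.single i (1 : R) from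
        funext fun i => Pi.basisFun_apply R ι i] at this

/-- The ideal generated by the maximal minors of the matrix whose rows are the elements of `K`. -/
def Submodule.maximalMinorIdeal {R ι : Type*} [CommRing R] [Fintype ι] [DecidableEq ι]
    (K : Submodule R (ι → R)) : Ideal R :=
  Ideal.span {d : R | ∃ w : Matrix ι ι R, (∀ j, w j ∈ K) ∧ w.det = d}

namespace Submodule

variable {R ι κ M : Type*} [CommRing R] [Fintype ι] [DecidableEq ι] [Fintype κ] [DecidableEq κ]
  [AddCommGroup M] [Module R M]

theorem det_mem_maximalMinorIdeal {K : Submodule R (ι → R)} {w : Matrix ι ι R}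
    (hw : ∀ j, w j ∈ K) : w.det ∈ K.maximalMinorIdeal :=
  Ideal.subset_span ⟨w, hw, rfl⟩

theorem maximalMinorIdeal_le_iff {K : Submodule R (ι → R)} {I : Ideal R} :
    K.maximalMinorIdeal ≤ I ↔ ∀ w : Matrix ι ι R, (∀ j, w j ∈ K) → w.det ∈ I := by
  rw [maximalMinorIdeal, Ideal.span_le]
  exact ⟨fun h w hw => h ⟨w, hw, rfl⟩, fun h _ ⟨w, hw, hd⟩ => hd ▸ h w hw⟩

theorem maximalMinorIdeal_comap_funLeft_le (e : ι ≃ κ) (K : Submodule R (ι → R)) :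
    K.maximalMinorIdeal ≤ (K.comap (LinearMap.funLeft R R e)).maximalMinorIdeal := by
  refine maximalMinorIdeal_le_iff.2 fun w hw => ?_
  rw [← Matrix.det_submatrix_equiv_self e.symm]
  refine det_mem_maximalMinorIdeal fun j => ?_
  rw [Submodule.mem_comap]
  convert hw (e.symm j) using 1
  ext i
  simp [LinearMap.funLeft]

end Submodule

/-- The map `R^(ι ⊔ κ) → M` glued from `R^ι → M` and `R^κ → M`. -/
def LinearMap.coprodSum {R ι κ M : Type*} [CommRing R] [AddCommGroup M] [Module R M]
    (p : (ι → R) →ₗ[R] M) (q : (κ → R) →ₗ[R] M) : (ι ⊕ κ → R) →ₗ[R] M :=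
  p ∘ₗ LinearMap.funLeft R R Sum.inl + q ∘ₗ LinearMap.funLeft R R Sum.inr

namespace LinearMap

variable {R ι κ M : Type*} [CommRing R] [AddCommGroup M] [Module R M]

theorem coprodSum_apply (p : (ι → R) →ₗ[R] M) (q : (κ → R) →ₗ[R] M) (x : ι ⊕ κ → R) :
    p.coprodSum q x = p (x ∘ Sum.inl) + q (x ∘ Sum.inr) := rfl

theorem ker_coprodSum_comm (p : (ι → R) →ₗ[R] M) (q : (κ → R) →ₗ[R] M) :
    ker (p.coprodSum q) =
      (ker (q.coprodSum p)).comap (funLeft R R (Equiv.sumComm κ ι)) := by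
  ext x
  rw [mem_ker, Submodule.mem_comap, mem_ker, coprodSum_apply, coprodSum_apply, add_comm]
  rfl

theorem coprodSum_surjective_of_left {p : (ι → R) →ₗ[R] M} (hp : Function.Surjective p)
    (q : (κ → R) →ₗ[R] M) : Function.Surjective (p.coprodSum q) := fun m => by
  obtain ⟨x, rfl⟩ := hp m
  exact ⟨Sum.elim x 0, by simp [coprodSum_apply]⟩

theorem of_mul_transpose_toMatrix' {μ : Type*} [Fintype κ] [DecidableEq κ]
    (f : (κ → R) →ₗ[R] (ι → R)) (z : μ → κ → R) (j : μ) (i : ι) :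
    (Matrix.of z * (toMatrix' f).transpose) j i = f (z j) i := by
  rw [← toMatrix'_mulVec f (z j)]
  simp [Matrix.mul_apply, Matrix.mulVec, dotProduct, mul_comm]

variable [Fintype ι] [DecidableEq ι] [Fintype κ] [DecidableEq κ]

/-- If the relations modulo the image of `p` among the generators given by `q` are generated
by the columns of a square matrix, its determinant splits off from the maximal minors. -/
theorem maximalMinorIdeal_ker_coprodSum (p : (ι → R) →ₗ[R] M) (q : (κ → R) →ₗ[R] M)
    (g : (κ → R) →ₗ[R] (κ → R)) (hg : (range p).comap q = range g) :
    (ker (p.coprodSum q)).maximalMinorIdeal =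
      (ker p).maximalMinorIdeal * Ideal.span {LinearMap.det g} := by
  have hu : ∃ u : (κ → R) →ₗ[R] (ι → R), ∀ z, p (u z) = -q (g z) := by
    have : ∀ k : κ, ∃ x, p x = -q (g (Pi.single k 1)) := fun k => by
      have : g (Pi.single k 1) ∈ (range p).comap q := hg ▸ mem_range_self g _
      obtain ⟨x, hx⟩ := this
      exact ⟨-x, by rw [map_neg, hx]⟩
    choose x hx using this
    refine ⟨(Pi.basisFun R κ).constr R x, fun z => ?_⟩
    have : p ∘ₗ (Pi.basisFun R κ).constr R x = -(q ∘ₗ g) :=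
      (Pi.basisFun R κ).ext fun k => by simp [hx]
    exact LinearMap.congr_fun this z
  obtain ⟨u, hu⟩ := hu
  apply le_antisymm
  · refine Submodule.maximalMinorIdeal_le_iff.2 fun w hw => ?_
    have hz : ∀ j, ∃ z, g z = w j ∘ Sum.inr := fun j => by
      have : w j ∘ Sum.inr ∈ (range p).comap q := by
        have h := hw j
        rw [mem_ker, coprodSum_apply] at h
        exact ⟨-(w j ∘ Sum.inl), by rw [map_neg]; exact neg_eq_of_add_eq_zero_right h⟩
      rw [hg] at this
      exact this
    choose z hz using hz
    let A : Matrix (ι ⊕ κ) ι R := Matrix.of fun j => w j ∘ Sum.inl - u (z j)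
    have hA : ∀ j, A j ∈ ker p := fun j => by
      have h := hw j
      rw [mem_ker, coprodSum_apply] at h
      change p (w j ∘ Sum.inl - u (z j)) = 0
      rw [map_sub, hu, hz, sub_neg_eq_add, h]
    have hmul : w = Matrix.fromCols A (Matrix.of z) *
        Matrix.fromBlocks 1 0 (toMatrix' u).transpose (toMatrix' g).transpose := by
      rw [Matrix.fromCols_mul_fromBlocks]
      ext j (i | i)
      · simp [of_mul_transpose_toMatrix', A]
      · simp [of_mul_transpose_toMatrix', hz]
    rw [hmul, Matrix.det_mul, Matrix.det_fromBlocks_zero₁₂, Matrix.det_one, one_mul,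
      Matrix.det_transpose, det_toMatrix']
    refine Ideal.mul_mem_mul ?_ (Ideal.mem_span_singleton_self _)
    rw [← Matrix.det_transpose]
    refine Matrix.det_mem_of_minors_mem _ _ Sum.inl Sum.inl_injective fun ρ => ?_
    rw [← Matrix.det_transpose]
    exact Submodule.det_mem_maximalMinorIdeal fun j => hA (ρ j)
  · rw [Ideal.mul_le]
    intro a ha d hd
    obtain ⟨c, rfl⟩ := Ideal.mem_span_singleton'.1 hd
    rw [← mul_assoc, mul_comm a, mul_assoc]
    refine Ideal.mul_mem_left _ _ ?_
    suffices H : (ker p).maximalMinorIdeal ≤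
        Submodule.comap (LinearMap.mulRight R (LinearMap.det g))
          (ker (p.coprodSum q)).maximalMinorIdeal from H ha
    refine Submodule.maximalMinorIdeal_le_iff.2 fun w hw => ?_
    change w.det * LinearMap.det g ∈ (ker (p.coprodSum q)).maximalMinorIdeal
    rw [← det_toMatrix', ← Matrix.det_transpose (toMatrix' g),
      ← Matrix.det_fromBlocks_zero₁₂ w (toMatrix' u).transpose]
    refine Submodule.det_mem_maximalMinorIdeal ?_
    rintro (j | j)
    · rw [mem_ker, coprodSum_apply]
      have h1 : Matrix.fromBlocks w 0 (toMatrix' u).transpose (toMatrix' g).transpose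
        (Sum.inl j) ∘ Sum.inl = w j := rfl
      have h2 : Matrix.fromBlocks w 0 (toMatrix' u).transpose (toMatrix' g).transpose
        (Sum.inl j) ∘ Sum.inr = 0 := rfl
      rw [h1, h2, map_zero, add_zero]
      exact hw j
    · rw [mem_ker, coprodSum_apply]
      have h1 : Matrix.fromBlocks w 0 (toMatrix' u).transpose (toMatrix' g).transpose
        (Sum.inr j) ∘ Sum.inl = u (Pi.single j 1) := by
          ext i; simp [toMatrix'_apply]
      have h2 : Matrix.fromBlocks w 0 (toMatrix' u).transpose (toMatrix' g).transpose
        (Sum.inr j) ∘ Sum.inr = g (Pi.single j 1) := by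
          ext i; simp [toMatrix'_apply]
      rw [h1, h2, hu, neg_add_cancel]

theorem maximalMinorIdeal_ker_coprodSum_of_surjective {p : (ι → R) →ₗ[R] M}
    (hp : Function.Surjective p) (q : (κ → R) →ₗ[R] M) :
    (ker (p.coprodSum q)).maximalMinorIdeal = (ker p).maximalMinorIdeal := by
  rw [maximalMinorIdeal_ker_coprodSum p q id (by simp [range_eq_top.2 hp])]
  simp

theorem maximalMinorIdeal_ker_le {p : (ι → R) →ₗ[R] M} {q : (κ → R) →ₗ[R] M}
    (hp : Function.Surjective p) (hq : Function.Surjective q) :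
    (ker p).maximalMinorIdeal ≤ (ker q).maximalMinorIdeal := by
  rw [← maximalMinorIdeal_ker_coprodSum_of_surjective hp q,
    ← maximalMinorIdeal_ker_coprodSum_of_surjective hq p, ker_coprodSum_comm q p]
  exact Submodule.maximalMinorIdeal_comap_funLeft_le _ _

theorem maximalMinorIdeal_ker_eq {p : (ι → R) →ₗ[R] M} {q : (κ → R) →ₗ[R] M}
    (hp : Function.Surjective p) (hq : Function.Surjective q) :
    (ker p).maximalMinorIdeal = (ker q).maximalMinorIdeal :=
  (maximalMinorIdeal_ker_le hp hq).antisymm (maximalMinorIdeal_ker_le hq hp)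

end LinearMap

open LinearMap in
/-- The initial Fitting ideal can be computed from any finite set of generators. -/
theorem fittingIdeal_zero_eq_maximalMinorIdeal {R ι M : Type*} [CommRing R] [AddCommGroup M]
    [Module R M] [Fintype ι] [DecidableEq ι] {p : (ι → R) →ₗ[R] M}
    (hp : Function.Surjective p) :
    fittingIdeal R M 0 = (ker p).maximalMinorIdeal := by
  apply le_antisymm
  · refine iSup_le fun n => iSup_le fun π => iSup_le fun hπ => ?_
    rw [maximalMinorIdeal_ker_eq hp hπ, Ideal.span_le]
    rintro d ⟨ρ, c, hc, rfl⟩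
    rw [← Matrix.det_transpose]
    let w : Matrix (Fin n) (Fin n) R := Matrix.of c
    have hw : w.submatrix _root_.id ρ = w * (1 : Matrix (Fin n) (Fin n) R).submatrix _root_.id ρ := by
      ext i j
      simp [Matrix.mul_apply, Matrix.one_apply]
    change (w.submatrix _root_.id ρ).det ∈ _
    rw [hw, Matrix.det_mul]
    exact Ideal.mul_mem_right _ _ (Submodule.det_mem_maximalMinorIdeal hc)
  · let e := Fintype.equivFin ι
    have hq : Function.Surjective (p ∘ₗ funLeft R R e) :=
      hp.comp (funLeft_surjective_of_injective R R e e.injective)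
    refine (maximalMinorIdeal_ker_le hp hq).trans ?_
    refine le_trans ?_ (le_iSup₂_of_le (Fintype.card ι) (p ∘ₗ funLeft R R e)
      (le_iSup_of_le hq le_rfl))
    refine Submodule.maximalMinorIdeal_le_iff.2 fun w hw => Ideal.subset_span ?_
    exact ⟨_root_.id, w, hw, (Matrix.det_transpose w).symm⟩

/-- The `b`-th Fitting ideal is the sum of the initial Fitting ideals of the quotients by
submodules generated by `b` elements. -/
theorem fittingIdeal_eq_iSup_quotient (R : Type*) [CommRing R] (N : Type*) [AddCommGroup N]
    [Module R N] [Module.Finite R N] (b : ℕ) :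
    fittingIdeal R N b =
      ⨆ t : Fin b → N, fittingIdeal R (N ⧸ Submodule.span R (Set.range t)) 0 := by
  apply le_antisymm
  · refine iSup_le fun n => iSup_le fun π => iSup_le fun hπ => ?_
    rw [Ideal.span_le]
    rintro d ⟨ρ, c, hc, rfl⟩
    by_cases hρ : Function.Injective ρ
    swap
    · simp only [Function.Injective, not_forall] at hρ
      obtain ⟨x, y, hxy, hne⟩ := hρ
      rw [Matrix.det_zero_of_row_eq hne (by ext; simp [hxy])]
      exact Ideal.zero_mem _
    obtain ⟨σ, hσ⟩ : ∃ σ : Fin (n - b) ⊕ Fin (n - (n - b)) ≃ Fin n,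
        ∀ a, σ (Sum.inl a) = ρ a := by
      obtain ⟨g, hg⟩ := Finset.exists_equiv_extend_of_card_eq
        (α := Fin (n - b) ⊕ Fin (n - (n - b))) (t := (Finset.univ : Finset (Fin n)))
        (s := Finset.univ.map Function.Embedding.inl)
        (f := Sum.elim ρ fun i => ⟨i, by omega⟩) (by simp)
        (Finset.subset_univ _) (by
          intro x hx y hy hxy
          simp only [Finset.coe_map, Finset.coe_univ, Set.image_univ, Set.mem_range,
            Function.Embedding.inl_apply] at hx hy
          obtain ⟨x, rfl⟩ := hx
          obtain ⟨y, rfl⟩ := hy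
          exact congrArg _ (hρ hxy))
      exact ⟨g.trans (Equiv.subtypeUnivEquiv (by simp)), fun a => hg _ (by simp)⟩
    let t : Fin b → N := fun i =>
      if h : (i : ℕ) < n - (n - b) then π (Pi.single (σ (Sum.inr ⟨i, h⟩)) 1) else 0
    refine (le_iSup (fun t : Fin b → N =>
      fittingIdeal R (N ⧸ Submodule.span R (Set.range t)) 0) t) ?_
    rw [fittingIdeal_zero_eq_maximalMinorIdeal
      (p := (Submodule.span R (Set.range t)).mkQ ∘ₗ π)
      ((Submodule.mkQ_surjective _).comp hπ)]
    let w : Matrix (Fin n) (Fin n) R := Matrix.of fun j =>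
      Sum.elim c (fun i => Pi.single (σ (Sum.inr i)) 1) (σ.symm j)
    have hw : w.det = (Matrix.of fun a a' => c a' (ρ a)).det := by
      rw [← Matrix.det_submatrix_equiv_self σ,
        ← Matrix.det_transpose (Matrix.of fun a a' => c a' (ρ a))]
      have : w.submatrix σ σ = Matrix.fromBlocks (Matrix.of fun a a' => c a' (ρ a)).transpose
          (Matrix.of fun a i => c a (σ (Sum.inr i))) 0 1 := by
        ext (i | i) (j | j)
        · simp [w, ← hσ]
        · simp [w]
        · simp [w]
        · simp [w, Pi.single_apply, Matrix.one_apply, eq_comm]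
      rw [this, Matrix.det_fromBlocks_zero₂₁, Matrix.det_one, mul_one]
    rw [← hw]
    refine Submodule.det_mem_maximalMinorIdeal fun j => ?_
    obtain ⟨j, rfl⟩ := σ.surjective j
    rw [LinearMap.mem_ker, LinearMap.comp_apply, Submodule.mkQ_apply,
      Submodule.Quotient.mk_eq_zero,
      show w (σ j) = Sum.elim c (fun i => Pi.single (σ (Sum.inr i)) 1) j by ext; simp [w]]
    rcases j with j | j
    · simp [hc]
    · refine Submodule.subset_span ⟨⟨j, by omega⟩, ?_⟩
      simp [t]
  · obtain ⟨n, p, hp⟩ := Module.Finite.exists_fin' R N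
    refine iSup_le fun t => ?_
    rw [fittingIdeal_zero_eq_maximalMinorIdeal
      (p := (Submodule.span R (Set.range t)).mkQ ∘ₗ p)
      ((Submodule.mkQ_surjective _).comp hp)]
    refine le_trans ?_ (le_iSup₂_of_le n p (le_iSup_of_le hp le_rfl))
    choose v hv using fun i => hp (t i)
    refine Submodule.maximalMinorIdeal_le_iff.2 fun w hw => ?_
    refine Matrix.det_mem_of_forall_mem_span _
      (fun _ => (LinearMap.ker p : Set (Fin n → R)) ∪ Set.range v) (fun x hx => ?_) w
      (fun j => ?_)
    · have hidx : ∀ j : {j // x j ∉ LinearMap.ker p}, ∃ i, v i = x j := fun j =>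
        (hx j).resolve_left j.2
      choose idx hidx using hidx
      by_cases hinj : Function.Injective idx
      · classical
        have hcard : n ≤ Fintype.card {j // x j ∈ LinearMap.ker p} + b := by
          have h1 := Fintype.card_le_of_injective idx hinj
          have h2 := Fintype.card_subtype_compl (fun j => x j ∈ LinearMap.ker p)
          simp only [Fintype.card_fin] at h1 h2
          omega
        obtain ⟨f⟩ := Function.Embedding.nonempty_of_card_le (α := Fin (n - b))
          (β := {j // x j ∈ LinearMap.ker p}) (by simp only [Fintype.card_fin]; omega)
        refine Matrix.det_mem_of_minors_mem _ _ (fun a => (f a : Fin n))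
          (Subtype.val_injective.comp f.injective) fun ρ => Ideal.subset_span ?_
        exact ⟨ρ, fun a => x (f a), fun a => (f a).2, (Matrix.det_transpose _).symm⟩
      · simp only [Function.Injective, not_forall] at hinj
        obtain ⟨j, k, hjk, hne⟩ := hinj
        rw [Matrix.det_zero_of_row_eq (fun h => hne (Subtype.ext h))
          (by rw [← hidx j, ← hidx k, hjk])]
        exact Ideal.zero_mem _
    · have h : p (w j) ∈ (Submodule.span R (Set.range v)).map p := by
        have h := hw j
        rw [LinearMap.mem_ker, LinearMap.comp_apply, Submodule.mkQ_apply,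
          Submodule.Quotient.mk_eq_zero] at h
        rwa [Submodule.map_span, ← Set.range_comp, show ⇑p ∘ v = t from funext hv]
      rw [Submodule.span_union, Submodule.span_eq, sup_comm, ← Submodule.comap_map_eq]
      exact h

/-- The initial Fitting ideal is multiplicative on extensions with quadratically presented
quotient. -/
theorem fittingIdeal_quotient_map_subtype {R M : Type*} [CommRing R] [AddCommGroup M] [Module R M]
    (N : Submodule R M) [Module.Finite R N]
    (hquad : ∃ (n : ℕ) (g : (Fin n → R) →ₗ[R] (Fin n → R)) (π : (Fin n → R) →ₗ[R] (M ⧸ N)),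
      Function.Surjective π ∧ LinearMap.range g = LinearMap.ker π) (Y : Submodule R N) :
    fittingIdeal R (M ⧸ Y.map N.subtype) 0 =
      fittingIdeal R (N ⧸ Y) 0 * fittingIdeal R (M ⧸ N) 0 := by
  obtain ⟨n, g, π, hπ, hg⟩ := hquad
  obtain ⟨k, p, hp⟩ := Module.Finite.exists_fin' R N
  obtain ⟨q, hq⟩ := Module.projective_lifting_property N.mkQ π N.mkQ_surjective
  have hqN : ∀ x, q x ∈ N ↔ x ∈ LinearMap.range g := fun x => by
    rw [hg, LinearMap.mem_ker, ← hq, LinearMap.comp_apply, Submodule.mkQ_apply,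
      Submodule.Quotient.mk_eq_zero]
  have hquot : fittingIdeal R (M ⧸ N) 0 = Ideal.span {LinearMap.det g} := by
    have h0 : (LinearMap.ker (0 : (Fin 0 → R) →ₗ[R] (M ⧸ N))).maximalMinorIdeal = ⊤ := by
      rw [Ideal.eq_top_iff_one, ← Matrix.det_one (n := Fin 0)]
      exact Submodule.det_mem_maximalMinorIdeal fun j => j.elim0
    rw [fittingIdeal_zero_eq_maximalMinorIdeal
      (p := (0 : (Fin 0 → R) →ₗ[R] (M ⧸ N)).coprodSum π),
      LinearMap.maximalMinorIdeal_ker_coprodSum _ _ g, h0, Ideal.top_mul]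
    · rw [hg, LinearMap.range_zero]
      rfl
    · intro m
      obtain ⟨x, rfl⟩ := hπ m
      exact ⟨Sum.elim 0 x, by simp [LinearMap.coprodSum_apply]⟩
  let X := Y.map N.subtype
  have hX : X ≤ N := Submodule.map_subtype_le N Y
  let P := X.mkQ ∘ₗ N.subtype ∘ₗ p
  have hmem : ∀ m, X.mkQ m ∈ LinearMap.range P ↔ m ∈ N := fun m => by
    constructor
    · rintro ⟨x, hx⟩
      have := hX ((Submodule.Quotient.eq X).1 hx)
      exact (Submodule.sub_mem_iff_right N (p x).2).1 this
    · intro hm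
      obtain ⟨x, hx⟩ := hp ⟨m, hm⟩
      exact ⟨x, by simp [P, hx]⟩
  have hsurj : Function.Surjective (P.coprodSum (X.mkQ ∘ₗ q)) := fun m => by
    obtain ⟨m, rfl⟩ := X.mkQ_surjective m
    obtain ⟨y, hy⟩ := hπ (N.mkQ m)
    have : m - q y ∈ N := by
      rw [← hq] at hy
      exact (Submodule.Quotient.eq N).1 hy.symm
    obtain ⟨x, hx⟩ := (hmem _).2 this
    exact ⟨Sum.elim x y, by simp [LinearMap.coprodSum_apply, hx]⟩
  have hker : LinearMap.ker P = LinearMap.ker (Y.mkQ ∘ₗ p) := by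
    ext x
    simp [P, X]
  rw [hquot, fittingIdeal_zero_eq_maximalMinorIdeal hsurj,
    fittingIdeal_zero_eq_maximalMinorIdeal (p := Y.mkQ ∘ₗ p) (Y.mkQ_surjective.comp hp), ← hker]
  refine LinearMap.maximalMinorIdeal_ker_coprodSum _ _ g ?_
  ext x
  exact (hmem _).trans (hqN x)

theorem relativeFittingIdeal_zero_eq_iSup (R : Type*) [CommRing R] {M : Type*} [AddCommGroup M]
    [Module R M] (N : Submodule R M) (b : ℕ) :
    relativeFittingIdeal R M 0 b N = ⨆ t : Fin b → N,
      fittingIdeal R (M ⧸ (Submodule.span R (Set.range t)).map N.subtype) 0 := by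
  have hspan : ∀ t : Fin b → N, (Submodule.span R (Set.range t)).map N.subtype =
      Submodule.span R (Set.range fun i => (t i : M)) := fun t => by
    rw [Submodule.map_span, ← Set.range_comp]
    rfl
  have hcast : ∀ s : Fin b → M,
      Set.range (fun i : Fin (0 + b) => s (i.cast (Nat.zero_add b))) = Set.range s :=
    fun s => (finCongr (Nat.zero_add b)).surjective.range_comp s
  apply le_antisymm
  · refine iSup₂_le fun X hX => ?_
    obtain ⟨s, hs, rfl⟩ := hX
    refine le_iSup_of_le
      (fun i => ⟨s (i.cast (Nat.zero_add b).symm), hs _ (by simp)⟩) ?_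
    rw [hspan, ← hcast]
    exact le_rfl
  · refine iSup_le fun t => le_iSup₂_of_le _
      ⟨fun i => (t (i.cast (Nat.zero_add b)) : M), fun i _ => (t _).2, ?_⟩ le_rfl
    rw [hspan, ← hcast]

/-- **Statement 13.** Let `R` be a commutative noetherian ring, `M` a finitely generated
`R`-module and `N ⊆ M` a submodule such that `M/N` admits a quadratic presentation, i.e. an
exact sequence `R^n → R^n → M/N → 0` for some `n`.  Then for every integer `b ≥ 0` one has
`Fitt^{(0,b)}_R(M,N) = Fitt^b_R(N) · Fitt^0_R(M/N)`; equivalently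
`Σ_X Fitt^0_R(M/X) = Fitt^b_R(N) · Fitt^0_R(M/N)`, the sum being over all submodules `X`
of `N` generated by `b` elements. -/
theorem relativeFittingIdeal_eq_of_quadratic_presentation
    (R : Type*) [CommRing R] [IsNoetherianRing R]
    (M : Type*) [AddCommGroup M] [Module R M] [Module.Finite R M]
    (N : Submodule R M)
    (hquad : ∃ (n : ℕ) (g : (Fin n → R) →ₗ[R] (Fin n → R)) (π : (Fin n → R) →ₗ[R] (M ⧸ N)),
      Function.Surjective π ∧ LinearMap.range g = LinearMap.ker π) (b : ℕ) :
    relativeFittingIdeal R M 0 b N =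
      fittingIdeal R N b * fittingIdeal R (M ⧸ N) 0 := by
  have : Module.Finite R N := Module.Finite.of_fg (IsNoetherian.noetherian N)
  rw [relativeFittingIdeal_zero_eq_iSup, fittingIdeal_eq_iSup_quotient, Ideal.iSup_mul]
  exact iSup_congr fun t => fittingIdeal_quotient_map_subtype N hquad _
end
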